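/- Let μ be a probability on L-sentences and (φ_n) a sequence of sentences such that φ_{n+1} → φ_n is valid for every n and the theory {φ_n : n ∈ ℕ} has no nonempty model. Then there exists n₀ such that φ_{n₀} is unsatisfiable; consequently μ(φ_n) = 0 for all n ≥ n₀, and in particular lim_{n→∞} μ(φ_n) = 0. -/

import Mathlib

open FirstOrder Language Filter

/-- A sentence is valid if it is satisfied by every nonempty structure. -/
def IsValidSentence (L : FirstOrder.Language) (φ : L.Sentence) : Prop :=
  ∀ (M : Type) [Nonempty M] [L.Structure M], M ⊨ φ

/-- A sentence is satisfiable if it is satisfied by some nonempty structure. -/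
def IsSatisfiableSentence (L : FirstOrder.Language) (φ : L.Sentence) : Prop :=
  ∃ (M : Type) (_ : L.Structure M), Nonempty M ∧ M ⊨ φ

/-- A probability on sentences. -/
structure SentenceProb (L : FirstOrder.Language) where
  toFun : L.Sentence → ℝ
  nonneg : ∀ φ, 0 ≤ toFun φ
  valid_one : ∀ φ, IsValidSentence L φ → toFun φ = 1
  add : ∀ φ ψ, IsValidSentence L (∼(φ ⊓ ψ)) → toFun (φ ⊔ ψ) = toFun φ + toFun ψ

theorem exists_model_of_decreasing_chain {L : FirstOrder.Language} (φ : ℕ → L.Sentence)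
    (hchain : ∀ n, IsValidSentence L (φ (n + 1) ⟹ φ n))
    (hsat : ∀ n, IsSatisfiableSentence L (φ n)) :
    ∃ (M : Type) (_ : L.Structure M), Nonempty M ∧ ∀ n, M ⊨ φ n := by
  choose M hstr hne hM using hsat
  have hdown : ∀ n k, k ≤ n → M n ⊨ φ k := fun n k hk =>
    Nat.decreasingInduction (motive := fun k _ => M n ⊨ φ k)
      (fun k _ h => (Sentence.realize_imp (M n)).1 (hchain k (M n)) h) (hM n) hk
  refine ⟨(hyperfilter ℕ : Filter ℕ).Product M, inferInstance, inferInstance, fun k => ?_⟩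
  rw [Ultraproduct.sentence_realize]
  exact Nat.hyperfilter_le_atTop ((eventually_ge_atTop k).mono fun n hn => hdown n k hn)

theorem SentenceProb.eq_zero_of_not_satisfiable {L : FirstOrder.Language} (μ : SentenceProb L)
    {φ : L.Sentence} (hφ : ¬ IsSatisfiableSentence L φ) : μ.toFun φ = 0 := by
  have hfalse : ∀ (M : Type) [Nonempty M] [L.Structure M], ¬ M ⊨ φ :=
    fun M hne hstr h => hφ ⟨M, hstr, hne, h⟩
  have htop : μ.toFun ⊤ = 1 := μ.valid_one _ fun M _ _ => by simp [Sentence.Realize]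
  have hsup : μ.toFun (φ ⊔ ⊤) = 1 := μ.valid_one _ fun M _ _ => by
    simp [Sentence.Realize, Formula.Realize]
  have hadd := μ.add φ ⊤ fun M _ _ => by
    rw [Sentence.realize_not]
    exact fun h => hfalse M (Formula.realize_inf.1 h).1
  linarith

theorem decreasing_chain_with_no_model_eventually_unsatisfiable
    {L : FirstOrder.Language} (μ : SentenceProb L) (φ : ℕ → L.Sentence)
    (hchain : ∀ n, IsValidSentence L (φ (n + 1) ⟹ φ n))
    (hnomodel : ¬ ∃ (M : Type) (_ : L.Structure M),
      Nonempty M ∧ ∀ n, M ⊨ φ n) :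
    ∃ n₀, ¬ IsSatisfiableSentence L (φ n₀) ∧
      (∀ n ≥ n₀, μ.toFun (φ n) = 0) ∧
      Tendsto (fun n => μ.toFun (φ n)) atTop (nhds 0) := by
  obtain ⟨n₀, hn₀⟩ : ∃ n₀, ¬ IsSatisfiableSentence L (φ n₀) := by
    by_contra! h
    exact hnomodel (exists_model_of_decreasing_chain φ hchain h)
  have hunsat : ∀ n ≥ n₀, ¬ IsSatisfiableSentence L (φ n) := fun n hn =>
    Nat.le_induction hn₀ (fun n _ ih ⟨M, hstr, hne, h⟩ =>
      ih ⟨M, hstr, hne, (Sentence.realize_imp M).1 (hchain n M) h⟩) n hn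
  have hzero : ∀ n ≥ n₀, μ.toFun (φ n) = 0 := fun n hn =>
    μ.eq_zero_of_not_satisfiable (hunsat n hn)
  exact ⟨n₀, hn₀, hzero, tendsto_const_nhds.congr'
    ((eventually_ge_atTop n₀).mono fun n hn => (hzero n hn).symm)⟩
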